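/- arXiv:2602.01877 — 4 statements merged into one kernel-verified Lean document; each statement's English description precedes it below -/
import Mathlib

section
/- Let (Ξ, ℬ, u) be a measure space, g₁ : Ξ → [0,∞) measurable, and M : Ξ → (real symmetric positive semidefinite n×n matrices) measurable, such that c₁ := ∫_Ξ g₁(ξ) u(dξ) is finite and strictly positive and C₂ := ∫_Ξ M(ξ) g₁(ξ) u(dξ) is finite entrywise. Let D₁ be a real symmetric positive definite n×n matrix, μ₀ ∈ ℝ, and e, x⁰ ∈ ℝⁿ. Then C₂ is symmetric positive semidefinite, c₁D₁ + C₂ is invertible, and the function ℶ(x) = ∫_Ξ [ (x − μ₀e)ᵀ D₁ (x − μ₀e) + (x − x⁰)ᵀ M(ξ) (x − x⁰) ] g₁(ξ) u(dξ) has the unique global minimizer x_OVE = (c₁D₁ + C₂)⁻¹ ( μ₀ c₁ D₁ e + C₂ x⁰ ) over ℝⁿ. -/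
open Matrix MeasureTheory

section QuadraticForm

variable {ι : Type*} [Fintype ι]

/-- Completing the square for a sum of two quadratic forms centred at `a` and `b`. -/
theorem Matrix.quadratic_add_quadratic_eq {P Q : Matrix ι ι ℝ} (hP : P.IsSymm) (hQ : Q.IsSymm)
    {a b z : ι → ℝ} (hz : (P + Q) *ᵥ z = P *ᵥ a + Q *ᵥ b) (x : ι → ℝ) :
    (x - a) ⬝ᵥ (P *ᵥ (x - a)) + (x - b) ⬝ᵥ (Q *ᵥ (x - b)) =
      (x - z) ⬝ᵥ ((P + Q) *ᵥ (x - z)) +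
        ((z - a) ⬝ᵥ (P *ᵥ (z - a)) + (z - b) ⬝ᵥ (Q *ᵥ (z - b))) := by
  have expand {S : Matrix ι ι ℝ} (hS : S.IsSymm) (v w : ι → ℝ) :
      (v + w) ⬝ᵥ (S *ᵥ (v + w)) =
        v ⬝ᵥ (S *ᵥ v) + 2 * (v ⬝ᵥ (S *ᵥ w)) + w ⬝ᵥ (S *ᵥ w) := by
    have hsymm : w ⬝ᵥ (S *ᵥ v) = v ⬝ᵥ (S *ᵥ w) := by
      rw [dotProduct_mulVec, ← mulVec_transpose, hS.eq, dotProduct_comm]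
    simp only [mulVec_add, dotProduct_add, add_dotProduct, hsymm]
    ring
  have cross : (x - z) ⬝ᵥ (P *ᵥ (z - a)) + (x - z) ⬝ᵥ (Q *ᵥ (z - b)) = 0 := by
    have hzero : P *ᵥ (z - a) + Q *ᵥ (z - b) = 0 := by
      rw [mulVec_sub, mulVec_sub, sub_add_sub_comm, ← add_mulVec, hz, sub_self]
    rw [← dotProduct_add, hzero, dotProduct_zero]
  rw [← sub_add_sub_cancel x z a, ← sub_add_sub_cancel x z b, expand hP, expand hQ,
    add_mulVec, dotProduct_add]
  linear_combination 2 * cross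

variable {Ξ : Type*} [MeasurableSpace Ξ] {u : Measure Ξ} {M : Ξ → Matrix ι ι ℝ} {g : Ξ → ℝ}

theorem Matrix.dotProduct_mulVec_mul_eq_sum (A : Matrix ι ι ℝ) (v w : ι → ℝ) (r : ℝ) :
    v ⬝ᵥ (A *ᵥ w) * r = ∑ i, ∑ j, v i * w j * (A i j * r) := by
  simp only [dotProduct, mulVec, Finset.mul_sum, Finset.sum_mul]
  exact Finset.sum_congr rfl fun i _ => Finset.sum_congr rfl fun j _ => by ring

theorem MeasureTheory.integrable_dotProduct_mulVec_mul
    (hM : ∀ i j, Integrable (fun ξ => M ξ i j * g ξ) u) (v w : ι → ℝ) :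
    Integrable (fun ξ => v ⬝ᵥ (M ξ *ᵥ w) * g ξ) u := by
  simp only [dotProduct_mulVec_mul_eq_sum]
  exact integrable_finsetSum _ fun i _ => integrable_finsetSum _ fun j _ => (hM i j).const_mul _

theorem MeasureTheory.integral_dotProduct_mulVec_mul
    (hM : ∀ i j, Integrable (fun ξ => M ξ i j * g ξ) u) (v w : ι → ℝ) :
    ∫ ξ, v ⬝ᵥ (M ξ *ᵥ w) * g ξ ∂u =
      v ⬝ᵥ (Matrix.of (fun i j => ∫ ξ, M ξ i j * g ξ ∂u) *ᵥ w) := by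
  rw [← mul_one (v ⬝ᵥ (Matrix.of _ *ᵥ w)), dotProduct_mulVec_mul_eq_sum _ v w 1]
  simp only [dotProduct_mulVec_mul_eq_sum, of_apply, mul_one]
  rw [integral_finsetSum _ fun i _ =>
    integrable_finsetSum _ fun j _ => (hM i j).const_mul _]
  refine Finset.sum_congr rfl fun i _ => ?_
  rw [integral_finsetSum _ fun j _ => (hM i j).const_mul _]
  exact Finset.sum_congr rfl fun j _ => integral_const_mul (v i * w j) _

/-- An entrywise nonnegatively weighted integral of positive semidefinite matrices is positive
semidefinite. -/
theorem MeasureTheory.posSemidef_integral_mul (hg : ∀ ξ, 0 ≤ g ξ)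
    (hMpsd : ∀ ξ, (M ξ).PosSemidef) (hM : ∀ i j, Integrable (fun ξ => M ξ i j * g ξ) u) :
    (Matrix.of fun i j => ∫ ξ, M ξ i j * g ξ ∂u).PosSemidef := by
  refine .of_dotProduct_mulVec_nonneg ?_ fun v => ?_
  · ext i j
    have hsymm (ξ : Ξ) : M ξ j i = M ξ i j := by simpa using (hMpsd ξ).isHermitian.apply i j
    simp [hsymm]
  · rw [star_trivial, ← integral_dotProduct_mulVec_mul hM]
    exact integral_nonneg fun ξ =>
      mul_nonneg (by simpa using (hMpsd ξ).dotProduct_mulVec_nonneg v) (hg ξ)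

end QuadraticForm

/-- Closed-form autocorrelated-OVE (A-OVE) portfolio decision: the prior-weighted mixture
`ℶ` of quadratic expected trading-cost objectives admits the unique global minimizer
`x_OVE = (c₁D₁ + C₂)⁻¹ (μ₀ c₁ D₁ e + C₂ x⁰)`, where `c₁ = ∫ g₁ du` and
`C₂ = ∫ M(ξ) g₁(ξ) u(dξ)` is positive semidefinite. -/
theorem stmt6 {Ξ : Type*} [MeasurableSpace Ξ] (u : Measure Ξ) {n : ℕ}
    (g₁ : Ξ → ℝ) (hg₁meas : Measurable g₁) (hg₁nonneg : ∀ ξ, 0 ≤ g₁ ξ)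
    (M : Ξ → Matrix (Fin n) (Fin n) ℝ)
    (hMmeas : ∀ i j, Measurable fun ξ => M ξ i j)
    (hMpsd : ∀ ξ, (M ξ).PosSemidef)
    (hg₁int : Integrable g₁ u) (hc₁pos : 0 < ∫ ξ, g₁ ξ ∂u)
    (hMint : ∀ i j, Integrable (fun ξ => M ξ i j * g₁ ξ) u)
    (D₁ : Matrix (Fin n) (Fin n) ℝ) (hD₁ : D₁.PosDef)
    (μ₀ : ℝ) (e x0 : Fin n → ℝ) :
    let c₁ : ℝ := ∫ ξ, g₁ ξ ∂u
    let C₂ : Matrix (Fin n) (Fin n) ℝ := Matrix.of fun i j => ∫ ξ, M ξ i j * g₁ ξ ∂u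
    let beth : (Fin n → ℝ) → ℝ := fun x =>
      ∫ ξ, ((x - μ₀ • e) ⬝ᵥ (D₁ *ᵥ (x - μ₀ • e))
            + (x - x0) ⬝ᵥ (M ξ *ᵥ (x - x0))) * g₁ ξ ∂u
    let xOVE : Fin n → ℝ := (c₁ • D₁ + C₂)⁻¹ *ᵥ ((μ₀ * c₁) • (D₁ *ᵥ e) + C₂ *ᵥ x0)
    C₂.PosSemidef ∧
    IsUnit (c₁ • D₁ + C₂) ∧
    (∀ x, beth xOVE ≤ beth x) ∧
    (∀ y, (∀ x, beth y ≤ beth x) → y = xOVE) := by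
  intro c₁ C₂ beth xOVE
  have hC₂ : C₂.PosSemidef := posSemidef_integral_mul hg₁nonneg hMpsd hMint
  have hP : (c₁ • D₁).PosDef := hD₁.smul hc₁pos
  have hA : (c₁ • D₁ + C₂).PosDef := hP.add_posSemidef hC₂
  have hbeth (x : Fin n → ℝ) : beth x =
      (x - μ₀ • e) ⬝ᵥ ((c₁ • D₁) *ᵥ (x - μ₀ • e)) + (x - x0) ⬝ᵥ (C₂ *ᵥ (x - x0)) := by
    simp only [beth, add_mul]
    rw [integral_add (hg₁int.const_mul _) (integrable_dotProduct_mulVec_mul hMint _ _),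
      integral_const_mul, integral_dotProduct_mulVec_mul hMint, smul_mulVec, dotProduct_smul,
      smul_eq_mul, mul_comm]
  have hz : (c₁ • D₁ + C₂) *ᵥ xOVE = (c₁ • D₁) *ᵥ (μ₀ • e) + C₂ *ᵥ x0 := by
    simp only [xOVE]
    rw [mulVec_mulVec, mul_nonsing_inv _ ((isUnit_iff_isUnit_det _).1 hA.isUnit), one_mulVec,
      smul_mulVec, mulVec_smul, smul_smul, mul_comm]
  have hsquare (x : Fin n → ℝ) :
      beth x = (x - xOVE) ⬝ᵥ ((c₁ • D₁ + C₂) *ᵥ (x - xOVE)) + beth xOVE := by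
    rw [hbeth, hbeth]
    exact quadratic_add_quadratic_eq (by simpa using hP.isHermitian)
      (by simpa using hC₂.isHermitian) hz x
  refine ⟨hC₂, hA.isUnit, fun x => ?_, fun y hy => ?_⟩
  · have := hA.posSemidef.dotProduct_mulVec_nonneg (x - xOVE)
    rw [star_trivial] at this
    linarith [hsquare x]
  · by_contra hne
    have := hA.dotProduct_mulVec_pos (sub_ne_zero.2 hne)
    rw [star_trivial] at this
    linarith [hsquare y, hy xOVE]
end

section
/- Let n, p, q ∈ ℕ, and let Φ₁, …, Φ_p, Θ₁, …, Θ_q and Σ_ε be real symmetric n×n matrices such that all of these matrices pairwise commute. For z ∈ ℂ with z ≠ 0, define the complex n×n matrix polynomials Φ(z) = Iₙ − Σ_{j=1}^p Φⱼ zʲ and Θ(z) = Iₙ + Σ_{i=1}^q Θᵢ zⁱ (with the real matrices viewed as complex matrices). If Φ(z) and Φ(z⁻¹) are both invertible, then Φ(z)⁻¹ Θ(z) Σ_ε Θ(z⁻¹)ᵀ (Φ(z⁻¹)ᵀ)⁻¹ = Φ(z⁻¹)⁻¹ Θ(z⁻¹) Σ_ε Θ(z)ᵀ (Φ(z)ᵀ)⁻¹,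 where ᵀ denotes the (non-conjugating) matrix transpose. -/
open Matrix

theorem Commute.mul_mul_mul_mul_reverse {M : Type*} [Monoid M] {a b c d s : M}
    (hab : Commute a b) (hac : Commute a c) (had : Commute a d) (has : Commute a s)
    (hbc : Commute b c) (hbd : Commute b d) (hbs : Commute b s)
    (hcd : Commute c d) (hcs : Commute c s) (hds : Commute d s) :
    a * c * s * d * b = b * d * s * c * a := by
  have hb : Commute b (a * c * s * d) :=
    ((hab.symm.mul_right hbc).mul_right hbs).mul_right hbd
  have ha : Commute a (c * s * d) := (hac.mul_right has).mul_right had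
  have hd : Commute d (c * s) := hcd.symm.mul_right hds
  calc a * c * s * d * b = b * (a * (c * s * d)) := by
        rw [← hb.eq]; simp only [mul_assoc]
    _ = b * (d * (s * c) * a) := by rw [ha.eq, ← hd.eq, hcs.eq]
    _ = b * d * s * c * a := by simp only [mul_assoc]

theorem Commute.matrix_map {n R S : Type*} [Fintype n] [NonAssocSemiring R] [NonAssocSemiring S]
    {A B : Matrix n n R} (h : Commute A B) (f : R →+* S) : Commute (A.map f) (B.map f) := by
  rw [commute_iff_eq, ← Matrix.map_mul, ← Matrix.map_mul, h.eq]

theorem Commute.sum_smul_right {ι R A : Type*} [Fintype ι] [Semiring R] [Semiring A] [Module R A]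
    [SMulCommClass R A A] [IsScalarTower R A A] {a : A} {f : ι → A}
    (h : ∀ i, Commute a (f i)) (r : ι → R) : Commute a (∑ i, r i • f i) :=
  Commute.sum_right _ _ _ fun i _ => (h i).smul_right (r i)

theorem Matrix.isSymm_sum_smul_map {ι n R S : Type*} [Fintype ι] [Semiring S]
    {F : ι → Matrix n n R} (h : ∀ i, (F i).IsSymm) (f : R → S) (r : ι → S) :
    (∑ i, r i • (F i).map f).IsSymm := by
  simp only [Matrix.IsSymm, Matrix.transpose_sum, Matrix.transpose_smul,
    ((h _).map f).eq]

/-- Symmetric-covariance condition for a VARMA(p,q) process: if all parameter matrices are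
symmetric and pairwise commute, then for every `z ≠ 0` with `Φ(z)` and `Φ(z⁻¹)` invertible,
`Φ(z)⁻¹ Θ(z) Σ_ε Θ(z⁻¹)ᵀ (Φ(z⁻¹)ᵀ)⁻¹ = Φ(z⁻¹)⁻¹ Θ(z⁻¹) Σ_ε Θ(z)ᵀ (Φ(z)ᵀ)⁻¹`. -/
theorem stmt7 {n p q : ℕ}
    (Φ : Fin p → Matrix (Fin n) (Fin n) ℝ) (Θ : Fin q → Matrix (Fin n) (Fin n) ℝ)
    (Sε : Matrix (Fin n) (Fin n) ℝ)
    (hΦsym : ∀ j, (Φ j).IsSymm) (hΘsym : ∀ i, (Θ i).IsSymm) (hSsym : Sε.IsSymm)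
    (hΦΦ : ∀ i j, Commute (Φ i) (Φ j)) (hΘΘ : ∀ i j, Commute (Θ i) (Θ j))
    (hΦΘ : ∀ i j, Commute (Φ i) (Θ j))
    (hΦS : ∀ i, Commute (Φ i) Sε) (hΘS : ∀ i, Commute (Θ i) Sε)
    (z : ℂ) (hz : z ≠ 0) :
    let Φp : ℂ → Matrix (Fin n) (Fin n) ℂ := fun w =>
      1 - ∑ j : Fin p, w ^ ((j : ℕ) + 1) • (Φ j).map Complex.ofReal
    let Θp : ℂ → Matrix (Fin n) (Fin n) ℂ := fun w =>
      1 + ∑ i : Fin q, w ^ ((i : ℕ) + 1) • (Θ i).map Complex.ofReal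
    let Sc : Matrix (Fin n) (Fin n) ℂ := Sε.map Complex.ofReal
    IsUnit (Φp z) → IsUnit (Φp z⁻¹) →
    (Φp z)⁻¹ * Θp z * Sc * (Θp z⁻¹)ᵀ * ((Φp z⁻¹)ᵀ)⁻¹
      = (Φp z⁻¹)⁻¹ * Θp z⁻¹ * Sc * (Θp z)ᵀ * ((Φp z)ᵀ)⁻¹ := by
  intro Φp Θp Sc hu hv
  have hΦt (w : ℂ) : (Φp w)ᵀ = Φp w :=
    Matrix.isSymm_one.sub (Matrix.isSymm_sum_smul_map hΦsym _ _)
  have hΘt (w : ℂ) : (Θp w)ᵀ = Θp w :=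
    Matrix.isSymm_one.add (Matrix.isSymm_sum_smul_map hΘsym _ _)
  have hΦ_right {X : Matrix (Fin n) (Fin n) ℂ}
      (h : ∀ j, Commute X ((Φ j).map Complex.ofReal)) (w : ℂ) : Commute X (Φp w) :=
    (Commute.one_right X).sub_right (Commute.sum_smul_right h _)
  have hΘ_right {X : Matrix (Fin n) (Fin n) ℂ}
      (h : ∀ i, Commute X ((Θ i).map Complex.ofReal)) (w : ℂ) : Commute X (Θp w) :=
    (Commute.one_right X).add_right (Commute.sum_smul_right h _)
  have hcΦΦ (w w' : ℂ) : Commute (Φp w) (Φp w') :=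
    hΦ_right (fun j => (hΦ_right (fun i => (hΦΦ j i).matrix_map Complex.ofRealHom) w).symm) w'
  have hcΦΘ (w w' : ℂ) : Commute (Φp w) (Θp w') :=
    hΘ_right (fun j => (hΦ_right (fun i => (hΦΘ i j).symm.matrix_map Complex.ofRealHom) w).symm) w'
  have hcΘΘ (w w' : ℂ) : Commute (Θp w) (Θp w') :=
    hΘ_right (fun j => (hΘ_right (fun i => (hΘΘ j i).matrix_map Complex.ofRealHom) w).symm) w'
  have hcΦS (w : ℂ) : Commute (Φp w) Sc :=
    (hΦ_right (fun i => (hΦS i).symm.matrix_map Complex.ofRealHom) w).symm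
  have hcΘS (w : ℂ) : Commute (Θp w) Sc :=
    (hΘ_right (fun i => (hΘS i).symm.matrix_map Complex.ofRealHom) w).symm
  simp only [hΦt, hΘt]
  obtain ⟨u, hu⟩ := hu
  obtain ⟨v, hv⟩ := hv
  have huv := hcΦΦ z z⁻¹
  have huΘ := hcΦΘ z
  have hvΘ := hcΦΘ z⁻¹
  have huS := hcΦS z
  have hvS := hcΦS z⁻¹
  rw [← hu] at huv huΘ huS ⊢
  rw [← hv] at huv hvΘ hvS ⊢
  rw [← Matrix.coe_units_inv, ← Matrix.coe_units_inv]
  exact Commute.mul_mul_mul_mul_reverse huv.units_inv_left.units_inv_right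
    (huΘ _).units_inv_left (huΘ _).units_inv_left huS.units_inv_left
    (hvΘ _).units_inv_left (hvΘ _).units_inv_left hvS.units_inv_left
    (hcΘΘ _ _) (hcΘS _) (hcΘS _)
end

section
/- Let θ ∈ ℝ and let Σ_ε be a real symmetric positive definite n×n matrix. Define scalars by s₁ = 1 + θ², and for t ≥ 2, d_t = θ / s_{t−1} and s_t = 1 + θ² − θ d_t. Define matrices by Σ₁ = (1 + θ²) Σ_ε and, recursively for t ≥ 2, Θ_{t−1} = θ Σ_ε Σ_{t−1}⁻¹ and Σ_t = (1 + θ²) Σ_ε − Θ_{t−1} Σ_{t−1} Θ_{t−1}ᵀ. Then for every t ≥ 1: s_t ≥ 1 (so in particular s_t > 0), Σ_t = s_t Σ_ε (hence Σ_t is symmetric positive definite and invertible), and for every t ≥ 2, Θ_{t−1} = d_t Iₙ. -/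
open Matrix

/-- If the prediction-error covariance is `a Σ` with `a ≠ 0`, the innovation coefficient
`θ Σ (a Σ)⁻¹` is the scalar matrix `(θ / a) I`. -/
lemma smul_mul_inv_smul_eq {ι : Type*} [Fintype ι] [DecidableEq ι] {S : Matrix ι ι ℝ}
    (hS : IsUnit S) (θ : ℝ) {a : ℝ} (ha : a ≠ 0) :
    θ • (S * (a • S)⁻¹) = (θ / a) • (1 : Matrix ι ι ℝ) := by
  have hdet : IsUnit S.det := (Matrix.isUnit_iff_isUnit_det S).1 hS
  have hinv : (a • S)⁻¹ = a⁻¹ • S⁻¹ := by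
    refine Matrix.inv_eq_right_inv ?_
    rw [Matrix.smul_mul, Matrix.mul_smul, Matrix.mul_nonsing_inv S hdet, smul_smul,
      mul_inv_cancel₀ ha, one_smul]
  rw [hinv, Matrix.mul_smul, Matrix.mul_nonsing_inv S hdet, smul_smul, div_eq_mul_inv]

/-- Innovations-algorithm recursion for the forward-transformed VARMA(1,1) process with
MA matrix `θIₙ`: the prediction-error covariances satisfy `Σ_t = s_t Σ_ε` with `s_t ≥ 1`
(so each `Σ_t` is symmetric positive definite and invertible), and the innovation
coefficients collapse to scalars, `Θ_{t−1} = d_t Iₙ`. -/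
theorem stmt8 {n : ℕ} (θ : ℝ) (Sε : Matrix (Fin n) (Fin n) ℝ) (hSε : Sε.PosDef)
    (s d : ℕ → ℝ) (Sm Θm : ℕ → Matrix (Fin n) (Fin n) ℝ)
    (hs1 : s 1 = 1 + θ ^ 2)
    (hd : ∀ t, 2 ≤ t → d t = θ / s (t - 1))
    (hst : ∀ t, 2 ≤ t → s t = 1 + θ ^ 2 - θ * d t)
    (hS1 : Sm 1 = (1 + θ ^ 2) • Sε)
    (hΘ : ∀ t, 2 ≤ t → Θm (t - 1) = θ • (Sε * (Sm (t - 1))⁻¹))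
    (hSt : ∀ t, 2 ≤ t →
      Sm t = (1 + θ ^ 2) • Sε - Θm (t - 1) * Sm (t - 1) * (Θm (t - 1))ᵀ) :
    (∀ t, 1 ≤ t →
      1 ≤ s t ∧ 0 < s t ∧ Sm t = s t • Sε ∧ (Sm t).PosDef ∧ IsUnit (Sm t)) ∧
    (∀ t, 2 ≤ t → Θm (t - 1) = d t • (1 : Matrix (Fin n) (Fin n) ℝ)) := by
  have hunit : IsUnit Sε := hSε.isUnit
  have hcoeff : ∀ t, 1 ≤ t → 1 ≤ s t → Sm t = s t • Sε → Θm t = d (t + 1) • 1 := by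
    intro t ht hs hSm
    have hΘt := hΘ (t + 1) (by omega)
    have hdt := hd (t + 1) (by omega)
    rw [Nat.add_sub_cancel] at hΘt hdt
    rw [hΘt, hSm, hdt, smul_mul_inv_smul_eq hunit θ (by positivity)]
  have hmain : ∀ t, 1 ≤ t → 1 ≤ s t ∧ Sm t = s t • Sε := by
    intro t ht
    induction t, ht using Nat.le_induction with
    | base => exact ⟨by rw [hs1]; nlinarith [sq_nonneg θ], by rw [hS1, hs1]⟩
    | succ t ht ih =>
      obtain ⟨hs, hSm⟩ := ih
      have hpos : 0 < s t := by linarith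
      have hdt := hd (t + 1) (by omega)
      have hs' := hst (t + 1) (by omega)
      have hS' := hSt (t + 1) (by omega)
      rw [Nat.add_sub_cancel] at hdt hS'
      have hds : d (t + 1) * s t = θ := by rw [hdt, div_mul_cancel₀ _ hpos.ne']
      constructor
      · have hle : θ * d (t + 1) ≤ θ ^ 2 := by
          rw [hdt, ← mul_div_assoc, ← sq]
          exact div_le_self (sq_nonneg θ) hs
        linarith
      · rw [hS', hcoeff t ht hs hSm, hSm, hs', sub_smul _ (θ * _), Matrix.transpose_smul,
          Matrix.transpose_one, Matrix.smul_mul, Matrix.one_mul, Matrix.mul_smul,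
          Matrix.mul_one, smul_smul, smul_smul, mul_assoc, hds, mul_comm θ]
  refine ⟨fun t ht => ?_, fun t ht => ?_⟩
  · obtain ⟨hs, hSm⟩ := hmain t ht
    have hpos : 0 < s t := by linarith
    have hpd : (Sm t).PosDef := hSm ▸ hSε.smul hpos
    exact ⟨hs, hpos, hSm, hpd, hpd.isUnit⟩
  · obtain ⟨hs, hSm⟩ := hmain (t - 1) (by omega)
    have h := hcoeff (t - 1) (by omega) hs hSm
    rwa [Nat.sub_add_cancel (by omega)] at h
end

section
/- Let n ∈ ℕ, T ≥ 3, let Y₁, …, Y_T ∈ ℝⁿ, let Φ be a real n×n matrix, and let Θ₁, …, Θ_{T−1} be real n×n matrices. Define W_t = Y_t − Φ Y_{t+1} for 1 ≤ t ≤ T−1 and W_T = Y_T; R₁ = W₁ and R_t = W_t − Θ_{t−1} R_{t−1} for 2 ≤ t ≤ T; α₁ = Y₁ and α_t = Y_t − Θ_{t−1} α_{t−1} for 2 ≤ t ≤ T; β_t = Y_{t+1} for 1 ≤ t ≤ T−1; and C_{j,t} = (−1)ʲ Θ_{t−1} Θ_{t−2} ⋯ Θ_{t−j−1} for 0 ≤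 j ≤ t−2. Then R_T = α_T + Θ_{T−1} Φ β_{T−1} − Θ_{T−1} Σ_{j=0}^{T−3} C_{j,T−1} Φ β_{T−2−j}. -/
open Matrix

/-- Splitting off the leading factor of an alternating sum of products of consecutive matrices. -/
theorem sum_signed_prod_mulVec_succ {ι : Type*} [Fintype ι] [DecidableEq ι]
    {Θ : ℕ → Matrix ι ι ℝ} {C : ℕ → ℕ → Matrix ι ι ℝ}
    (hC : ∀ j t, j + 2 ≤ t →
      C j t = (-1 : ℝ) ^ j • (((List.range (j + 1)).map fun k => Θ (t - 1 - k)).prod))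
    (v : ℕ → ι → ℝ) (m : ℕ) :
    ∑ j ∈ Finset.range (m + 1), C j (m + 2) *ᵥ v (m + 1 - j) =
      Θ (m + 1) *ᵥ v (m + 1) -
        Θ (m + 1) *ᵥ ∑ j ∈ Finset.range m, C j (m + 1) *ᵥ v (m - j) := by
  have h_zero : C 0 (m + 2) = Θ (m + 1) := by simp [hC 0 (m + 2) (by lia)]
  have h_succ : ∀ j ∈ Finset.range m,
      C (j + 1) (m + 2) *ᵥ v (m + 1 - (j + 1)) =
        -(Θ (m + 1) *ᵥ (C j (m + 1) *ᵥ v (m - j))) := by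
    intro j hj
    rw [Finset.mem_range] at hj
    have h_mul : C (j + 1) (m + 2) = -(Θ (m + 1) * C j (m + 1)) := by
      have h_shift : (fun k => Θ (m + 2 - 1 - k)) ∘ Nat.succ = fun k => Θ (m + 1 - 1 - k) := by
        funext k
        exact congrArg Θ (by lia : m + 2 - 1 - k.succ = m + 1 - 1 - k)
      rw [hC (j + 1) (m + 2) (by lia), hC j (m + 1) (by lia), List.range_succ_eq_map,
        List.map_cons, List.prod_cons, List.map_map, h_shift, pow_succ, mul_neg_one, neg_smul,
        Matrix.mul_smul]
      rfl
    rw [h_mul, Matrix.neg_mulVec, Matrix.mulVec_mulVec, Nat.add_sub_add_right]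
  rw [Finset.sum_range_succ', Finset.sum_congr rfl h_succ, Finset.sum_neg_distrib,
    Matrix.mulVec_sum, h_zero, Nat.sub_zero]
  abel

/-- Closed form of the final innovation of the forward-transformed VARMA(1,1) sequence
(where `W_T = Y_T` differs from the earlier transforms):
`R_T = α_T + Θ_{T−1} Φ β_{T−1} − Θ_{T−1} Σ_{j=0}^{T−3} C_{j,T−1} Φ β_{T−2−j}`. -/
theorem stmt12 {n : ℕ} (T : ℕ) (hT : 3 ≤ T)
    (Y : ℕ → Fin n → ℝ) (Φ : Matrix (Fin n) (Fin n) ℝ)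
    (Θ : ℕ → Matrix (Fin n) (Fin n) ℝ)
    (W R α β : ℕ → Fin n → ℝ) (C : ℕ → ℕ → Matrix (Fin n) (Fin n) ℝ)
    (hW : ∀ t, 1 ≤ t → t ≤ T - 1 → W t = Y t - Φ *ᵥ Y (t + 1))
    (hWT : W T = Y T)
    (hR1 : R 1 = W 1)
    (hR : ∀ t, 2 ≤ t → t ≤ T → R t = W t - Θ (t - 1) *ᵥ R (t - 1))
    (hα1 : α 1 = Y 1)
    (hα : ∀ t, 2 ≤ t → t ≤ T → α t = Y t - Θ (t - 1) *ᵥ α (t - 1))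
    (hβ : ∀ t, 1 ≤ t → t ≤ T - 1 → β t = Y (t + 1))
    (hC : ∀ j t, j + 2 ≤ t →
      C j t = (-1 : ℝ) ^ j • (((List.range (j + 1)).map fun k => Θ (t - 1 - k)).prod)) :
    R T = α T + Θ (T - 1) *ᵥ (Φ *ᵥ β (T - 1))
      - Θ (T - 1) *ᵥ (∑ j ∈ Finset.range (T - 2), C j (T - 1) *ᵥ (Φ *ᵥ β (T - 2 - j))) := by
  have h_closed : ∀ m, m + 2 ≤ T → R (m + 1) = α (m + 1) - Φ *ᵥ β (m + 1) +
      ∑ j ∈ Finset.range m, C j (m + 1) *ᵥ (Φ *ᵥ β (m - j)) := by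
    intro m
    induction m with
    | zero =>
      intro hm
      simp [hR1, hα1, hW 1 le_rfl (by lia), hβ 1 le_rfl (by lia)]
    | succ m ih =>
      intro hm
      rw [sum_signed_prod_mulVec_succ hC (fun t => Φ *ᵥ β t), hR (m + 1 + 1) (by lia) (by lia),
        hW (m + 1 + 1) (by lia) (by lia), hα (m + 1 + 1) (by lia) (by lia),
        hβ (m + 1 + 1) (by lia) (by lia), Nat.add_sub_cancel, ih (by lia),
        Matrix.mulVec_add, Matrix.mulVec_sub]
      abel
  obtain ⟨m, rfl⟩ : ∃ m, T = m + 2 := ⟨T - 2, by lia⟩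
  rw [hR (m + 2) (by lia) le_rfl, hWT, hα (m + 2) (by lia) le_rfl]
  simp only [Nat.add_sub_cancel, show m + 2 - 1 = m + 1 from rfl]
  rw [h_closed m le_rfl, Matrix.mulVec_add, Matrix.mulVec_sub]
  abel
end
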